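/- Let C̲ be a G-coalgebra and M a right comodule over the smash coproduct C̲ ⋊ kG, with structure maps ρ_α : M → M ⊗ C_α ⊗ kG. Let M = ⊕_{σ∈G} M_σ be the grading determined by ρ_e, where m ∈ M_σ if and only if ρ_e(m) ∈ M ⊗ C_e ⊗ kσ⁻¹. Then for ω ∈ G and m ∈ M, the following are equivalent: (i) m ∈ M_ω; (ii) ρ_α(m) ∈ M ⊗ C_α ⊗ kω⁻¹ for all α ∈ G; (iii) writing ρ_α(m) = Σ_{σ∈G} m^σ_{[0]} ⊗ m^σ_{[1,α]} ⊗ σ⁻¹, one has m^σ_{[0]} ⊗ m^σ_{[1,α]} = 0 for all σ ≠ ω and all α ∈ G. -/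

import Mathlib

open TensorProduct

universe u

/-- A `G`-group coalgebra over `k`: a family of `k`-vector spaces `C α` with
comultiplications `Δ_{α,β} : C (α*β) → C α ⊗ C β` and a counit `ε : C 1 → k`.
The comultiplication takes an explicit proof `γ = α * β` to avoid dependent casts. -/
structure GCoalgebra (k : Type u) [Field k] (G : Type u) [Group G] where
  C : G → Type u
  [acg : ∀ α, AddCommGroup (C α)]
  [mod : ∀ α, Module k (C α)]
  Δ : ∀ ⦃γ⦄ (α β : G), γ = α * β → (C γ →ₗ[k] C α ⊗[k] C β)
  ε : C 1 →ₗ[k] k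
  coassoc : ∀ ⦃δ δ₁ δ₂ : G⦄ (α β γ : G) (h₁ : δ = δ₁ * γ) (h₁' : δ₁ = α * β)
      (h₂ : δ = α * δ₂) (h₂' : δ₂ = β * γ),
      (TensorProduct.assoc k (C α) (C β) (C γ)).toLinearMap ∘ₗ
        (TensorProduct.map (Δ α β h₁') LinearMap.id) ∘ₗ Δ δ₁ γ h₁
      = (TensorProduct.map LinearMap.id (Δ β γ h₂')) ∘ₗ Δ α δ₂ h₂
  counit_right : ∀ (α : G) (h : α = α * 1),
      (TensorProduct.rid k (C α)).toLinearMap ∘ₗ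
        (TensorProduct.map LinearMap.id ε) ∘ₗ Δ α 1 h = LinearMap.id
  counit_left : ∀ (α : G) (h : α = 1 * α),
      (TensorProduct.lid k (C α)).toLinearMap ∘ₗ
        (TensorProduct.map ε LinearMap.id) ∘ₗ Δ 1 α h = LinearMap.id

attribute [instance] GCoalgebra.acg GCoalgebra.mod

variable {k : Type u} [Field k] {G : Type u} [Group G]

/-- A right `G`-`C̲`-comodule. -/
structure GComodule (Cc : GCoalgebra k G) where
  M : G → Type u
  [acg : ∀ α, AddCommGroup (M α)]
  [mod : ∀ α, Module k (M α)]
  ρ : ∀ ⦃γ⦄ (α β : G), γ = α * β → (M γ →ₗ[k] M α ⊗[k] Cc.C β)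
  counit : ∀ (α : G) (h : α = α * 1),
      (TensorProduct.rid k (M α)).toLinearMap ∘ₗ
        (TensorProduct.map LinearMap.id Cc.ε) ∘ₗ ρ α 1 h = LinearMap.id
  coassoc : ∀ ⦃δ δ₁ δ₂ : G⦄ (α β γ : G) (h₁ : δ = δ₁ * γ) (h₁' : δ₁ = α * β)
      (h₂ : δ = α * δ₂) (h₂' : δ₂ = β * γ),
      (TensorProduct.assoc k (M α) (Cc.C β) (Cc.C γ)).toLinearMap ∘ₗ
        (TensorProduct.map (ρ α β h₁') LinearMap.id) ∘ₗ ρ δ₁ γ h₁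
      = (TensorProduct.map LinearMap.id (Cc.Δ β γ h₂')) ∘ₗ ρ α δ₂ h₂

attribute [instance] GComodule.acg GComodule.mod

/-- A morphism of right `G`-`C̲`-comodules. -/
structure GComodHom {Cc : GCoalgebra k G} (M N : GComodule Cc) where
  φ : ∀ α, M.M α →ₗ[k] N.M α
  colinear : ∀ ⦃γ⦄ (α β : G) (h : γ = α * β),
      (TensorProduct.map (φ α) LinearMap.id) ∘ₗ M.ρ α β h = N.ρ α β h ∘ₗ φ γ

/-- A `G`-coalgebra is strong if all comultiplication maps are injective. -/
def GCoalgebra.Strong (Cc : GCoalgebra k G) : Prop :=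
  ∀ (α β : G), Function.Injective (Cc.Δ α β rfl)
/-- The map `kG → kG ⊗ kG`, `σ ↦ βσ ⊗ σ`. -/
noncomputable def smashW (β : G) : (G →₀ k) →ₗ[k] (G →₀ k) ⊗[k] (G →₀ k) :=
  Finsupp.lsum k fun σ => LinearMap.toSpanSingleton k _
    (Finsupp.single (β * σ) (1 : k) ⊗ₜ Finsupp.single σ (1 : k))

/-- The augmentation `kG → k`, `σ ↦ 1`. -/
noncomputable def smashAug : (G →₀ k) →ₗ[k] k :=
  Finsupp.lsum k fun _ => LinearMap.id

/-- The comultiplication `Δ_{α,β}` of the smash coproduct `C̲ ⋊ kG`: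
`Δ_{α,β}(c ⊗ σ) = (c_{(1,α)} ⊗ βσ) ⊗ (c_{(2,β)} ⊗ σ)`. -/
noncomputable def smashΔ (Cc : GCoalgebra k G) ⦃γ : G⦄ (α β : G) (h : γ = α * β) :
    (Cc.C γ ⊗[k] (G →₀ k)) →ₗ[k]
      (Cc.C α ⊗[k] (G →₀ k)) ⊗[k] (Cc.C β ⊗[k] (G →₀ k)) :=
  (TensorProduct.tensorTensorTensorComm k (Cc.C α) (Cc.C β)
      (G →₀ k) (G →₀ k)).toLinearMap ∘ₗ
    TensorProduct.map (Cc.Δ α β h) (smashW β)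

/-- The counit of the smash coproduct: `ε(c ⊗ σ) = ε(c)`. -/
noncomputable def smashε (Cc : GCoalgebra k G) : (Cc.C 1 ⊗[k] (G →₀ k)) →ₗ[k] k :=
  LinearMap.mul' k k ∘ₗ TensorProduct.map Cc.ε smashAug
/-- A right comodule over the smash coproduct `C̲ ⋊ kG`. -/
structure SmashComodule (Cc : GCoalgebra k G) where
  X : Type u
  [acg : AddCommGroup X]
  [mod : Module k X]
  ρ : ∀ α : G, X →ₗ[k] X ⊗[k] (Cc.C α ⊗[k] (G →₀ k))
  counit : (TensorProduct.rid k X).toLinearMap ∘ₗ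
      (TensorProduct.map LinearMap.id (smashε Cc)) ∘ₗ ρ 1 = LinearMap.id
  coassoc : ∀ ⦃γ : G⦄ (α β : G) (h : γ = α * β),
      (TensorProduct.assoc k X (Cc.C α ⊗[k] (G →₀ k))
          (Cc.C β ⊗[k] (G →₀ k))).toLinearMap ∘ₗ
        (TensorProduct.map (ρ α) LinearMap.id) ∘ₗ ρ β
      = (TensorProduct.map LinearMap.id (smashΔ Cc α β h)) ∘ₗ ρ γ

attribute [instance] SmashComodule.acg SmashComodule.mod

/-- The embedding `X ⊗ C_α → X ⊗ (C_α ⊗ kG)`, `x ⊗ c ↦ x ⊗ (c ⊗ σ)`, whose range is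
`X ⊗ C_α ⊗ kσ`. -/
noncomputable def smashEmb (Cc : GCoalgebra k G) (X : Type u) [AddCommGroup X]
    [Module k X] (α σ : G) :
    (X ⊗[k] Cc.C α) →ₗ[k] X ⊗[k] (Cc.C α ⊗[k] (G →₀ k)) :=
  LinearMap.lTensor X ((TensorProduct.mk k (Cc.C α) (G →₀ k)).flip
    (Finsupp.single σ (1 : k)))

/-- The `τ`-component projection `X ⊗ (C_α ⊗ kG) → X ⊗ C_α` obtained by evaluating
the `kG`-coordinate at `τ`. -/
noncomputable def smashProj (Cc : GCoalgebra k G) (X : Type u) [AddCommGroup X]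
    [Module k X] (α τ : G) :
    (X ⊗[k] (Cc.C α ⊗[k] (G →₀ k))) →ₗ[k] X ⊗[k] Cc.C α :=
  LinearMap.lTensor X ((TensorProduct.rid k (Cc.C α)).toLinearMap ∘ₗ
    LinearMap.lTensor (Cc.C α) (Finsupp.lapply τ))

/-- The degree-`σ` part `M_σ = {m : ρ_e(m) ∈ M ⊗ C_e ⊗ kσ⁻¹}` of a right
`C̲ ⋊ kG`-comodule. -/
noncomputable def SmashComodule.grade {Cc : GCoalgebra k G} (M : SmashComodule Cc)
    (σ : G) : Submodule k M.X :=
  Submodule.comap (M.ρ 1) (LinearMap.range (smashEmb Cc M.X 1 σ⁻¹))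
lemma smashProj_smashEmb [DecidableEq G] (Cc : GCoalgebra k G) (X : Type u) [AddCommGroup X]
    [Module k X] (α σ τ : G) (y : X ⊗[k] Cc.C α) :
    smashProj Cc X α τ (smashEmb Cc X α σ y) = if σ = τ then y else 0 := by
  induction y with
  | zero => simp
  | add a b ha hb => rw [map_add, map_add, ha, hb]; split_ifs <;> simp
  | tmul x c =>
    by_cases h : σ = τ <;>
      simp [smashProj, smashEmb, h]

lemma lsum_smashEmb_surjective (Cc : GCoalgebra k G) (X : Type u) [AddCommGroup X]
    [Module k X] (α : G) :
    Function.Surjective (Finsupp.lsum k (smashEmb Cc X α)) := by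
  rw [← LinearMap.range_eq_top, eq_top_iff]
  rintro z -
  induction z with
  | zero => exact zero_mem _
  | add a b ha hb => exact add_mem ha hb
  | tmul x t =>
    induction t with
    | zero => simp
    | add a b ha hb => rw [tmul_add]; exact add_mem ha hb
    | tmul c f =>
      induction f using Finsupp.induction_linear with
      | zero => simp
      | add f g hf hg => rw [tmul_add, tmul_add]; exact add_mem hf hg
      | single σ a =>
        refine ⟨Finsupp.single σ (x ⊗ₜ (a • c)), ?_⟩
        simp [smashEmb, ← tmul_smul]

/-- An element of `X ⊗ C_α ⊗ kG` lies in `X ⊗ C_α ⊗ kσ` iff its other components vanish. -/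
lemma mem_range_smashEmb_iff (Cc : GCoalgebra k G) (X : Type u) [AddCommGroup X]
    [Module k X] (α σ : G) (z : X ⊗[k] (Cc.C α ⊗[k] (G →₀ k))) :
    z ∈ LinearMap.range (smashEmb Cc X α σ) ↔ ∀ τ, τ ≠ σ → smashProj Cc X α τ z = 0 := by
  classical
  constructor
  · rintro ⟨y, rfl⟩ τ hτ
    rw [smashProj_smashEmb, if_neg hτ.symm]
  · intro h
    obtain ⟨f, rfl⟩ := lsum_smashEmb_surjective Cc X α z
    have hproj (τ : G) : smashProj Cc X α τ (Finsupp.lsum k (smashEmb Cc X α) f) = f τ := by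
      simp only [Finsupp.lsum_apply, Finsupp.sum, map_sum, smashProj_smashEmb]
      simp +contextual [eq_comm]
    have hf : f = Finsupp.single σ (f σ) := by
      ext τ
      by_cases hτ : τ = σ
      · simp [hτ]
      · rw [← hproj, h τ hτ, Finsupp.single_eq_of_ne hτ]
    rw [hf]
    simp

/-- The functional `c ⊗ f ↦ ε(c) f(τ)` on `C_e ⊗ kG`. -/
noncomputable def smashCoeff (Cc : GCoalgebra k G) (τ : G) : (Cc.C 1 ⊗[k] (G →₀ k)) →ₗ[k] k :=
  LinearMap.mul' k k ∘ₗ TensorProduct.map Cc.ε (Finsupp.lapply τ)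

/-- The `τ`-component map `C_α ⊗ kG → C_α`. -/
noncomputable def smashComponent (Cc : GCoalgebra k G) (α τ : G) :
    (Cc.C α ⊗[k] (G →₀ k)) →ₗ[k] Cc.C α :=
  (TensorProduct.rid k (Cc.C α)).toLinearMap ∘ₗ LinearMap.lTensor (Cc.C α) (Finsupp.lapply τ)

/-- The `τ`-component can be read off after comultiplying, from the second tensor factor. -/
lemma smashComponent_comp_smashΔ (Cc : GCoalgebra k G) (α τ : G) (h : α = α * 1) :
    smashComponent Cc α τ ∘ₗ (TensorProduct.rid k _).toLinearMap ∘ₗ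
      LinearMap.lTensor _ (smashCoeff Cc τ) ∘ₗ smashΔ Cc α 1 h = smashComponent Cc α τ := by
  classical
  have key (d : Cc.C α ⊗[k] Cc.C 1) (x y : G →₀ k) :
      smashComponent Cc α τ (TensorProduct.rid k _ (LinearMap.lTensor _ (smashCoeff Cc τ)
        (tensorTensorTensorComm k _ _ _ _ (d ⊗ₜ (x ⊗ₜ y))))) =
      (x τ * y τ) • TensorProduct.rid k _ (TensorProduct.map LinearMap.id Cc.ε d) := by
    induction d with
    | zero => simp
    | add a b ha hb => simp only [add_tmul, map_add, ha, hb, smul_add]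
    | tmul c e =>
      simp [smashComponent, smashCoeff, smul_smul]
      ring_nf
  have counit (c : Cc.C α) : TensorProduct.rid k _
      (TensorProduct.map LinearMap.id Cc.ε (Cc.Δ α 1 h c)) = c :=
    LinearMap.congr_fun (Cc.counit_right α h) c
  ext c σ
  have hW : smashW (1 : G) (Finsupp.single σ (1 : k)) =
      Finsupp.single σ (1 : k) ⊗ₜ Finsupp.single σ (1 : k) := by
    simp [smashW]
  have := key (Cc.Δ α 1 h c) (Finsupp.single σ 1) (Finsupp.single σ 1)
  rw [counit, ← hW] at this
  by_cases hσ : σ = τ <;> simpa [smashΔ, smashComponent, hσ] using this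

lemma lTensor_smashCoeff_smashEmb (Cc : GCoalgebra k G) (X : Type u) [AddCommGroup X]
    [Module k X] {σ τ : G} (hτ : τ ≠ σ) (y : X ⊗[k] Cc.C 1) :
    LinearMap.lTensor X (smashCoeff Cc τ) (smashEmb Cc X 1 σ y) = 0 := by
  induction y with
  | zero => simp
  | add a b ha hb => rw [map_add, map_add, ha, hb, add_zero]
  | tmul x c => simp [smashEmb, smashCoeff, Finsupp.single_eq_of_ne hτ]

/-- The `τ`-component of `ρ_α(m)` is determined by the `τ`-component of `ρ_e(m)`. -/
lemma SmashComodule.smashProj_ρ {Cc : GCoalgebra k G} (M : SmashComodule Cc) (α τ : G) (m : M.X) :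
    smashProj Cc M.X α τ (M.ρ α m) =
      smashProj Cc M.X α τ (M.ρ α (TensorProduct.rid k M.X
        (LinearMap.lTensor M.X (smashCoeff Cc τ) (M.ρ 1 m)))) := by
  have key (z : M.X ⊗[k] (Cc.C 1 ⊗[k] (G →₀ k))) :
      LinearMap.lTensor M.X ((TensorProduct.rid k _).toLinearMap ∘ₗ
        LinearMap.lTensor _ (smashCoeff Cc τ)) (TensorProduct.assoc k _ _ _
          (TensorProduct.map (M.ρ α) LinearMap.id z)) =
      M.ρ α (TensorProduct.rid k M.X (LinearMap.lTensor M.X (smashCoeff Cc τ) z)) := by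
    induction z with
    | zero => simp
    | add a b ha hb => simp only [map_add, ha, hb]
    | tmul x t =>
      simp only [map_tmul, LinearMap.id_apply, LinearMap.lTensor_tmul, rid_tmul, map_smul]
      induction M.ρ α x with
      | zero => simp
      | add a b ha hb => simp only [add_tmul, map_add, ha, hb, smul_add]
      | tmul a b => simp
  have hco := LinearMap.congr_fun (M.coassoc α 1 (mul_one α).symm) m
  simp only [LinearMap.comp_apply, LinearEquiv.coe_coe] at hco
  rw [← key, hco]
  change LinearMap.lTensor M.X (smashComponent Cc α τ) _ =
    LinearMap.lTensor M.X (smashComponent Cc α τ) _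
  conv_lhs => rw [← smashComponent_comp_smashΔ Cc α τ (mul_one α).symm]
  simp only [LinearMap.lTensor_comp, LinearMap.comp_apply]
  rfl

/-- **Lemma 2.3.** For a right `C̲ ⋊ kG`-comodule `M`, `ω ∈ G` and `m ∈ M`,
the following are equivalent: (i) `m ∈ M_ω`; (ii) `ρ_α(m) ∈ M ⊗ C_α ⊗ kω⁻¹` for all
`α`; (iii) the `σ⁻¹`-components `m^σ_{[0]} ⊗ m^σ_{[1,α]}` of `ρ_α(m)` vanish for all
`σ ≠ ω` and all `α`. -/
theorem smash_comodule_grade_tfae (Cc : GCoalgebra k G) (M : SmashComodule Cc)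
    (ω : G) (m : M.X) :
    List.TFAE
      [ m ∈ M.grade ω,
        ∀ α : G, M.ρ α m ∈ LinearMap.range (smashEmb Cc M.X α ω⁻¹),
        ∀ (α σ : G), σ ≠ ω → smashProj Cc M.X α σ⁻¹ (M.ρ α m) = 0 ] := by
  tfae_have 2 → 1 := fun h => h 1
  tfae_have 1 → 3 := by
    rintro ⟨y, hy⟩ α σ hσ
    rw [M.smashProj_ρ, ← hy, lTensor_smashCoeff_smashEmb Cc M.X (inv_injective.ne hσ)]
    simp
  tfae_have 3 → 2 := by
    intro h α
    rw [mem_range_smashEmb_iff]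
    intro τ hτ
    have := h α τ⁻¹ (by rintro rfl; simp at hτ)
    rwa [inv_inv] at this
  tfae_finish
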